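/- Let K be a field and let f = a0*x^4 + a1*x^3*y + a2*x^3*z + a3*x^2*y^2 + a4*x^2*y*z + a5*x^2*z^2 + a6*x*y^3 + a7*x*y^2*z + a8*x*y*z^2 + a9*x*z^3 + a10*y^4 + a11*y^3*z + a12*y^2*z^2 + a13*y*z^3 + a14*z^4 ∈ K[x,y,z] with a10 = 0, a6 = 0 and a11 ≠ 0. Let c = γ1*x^3 + γ2*z^3 + β*x^2*y + γ3*x^2*z + γ4*x*z^2 + γ5*x*y*z + γ6*y^2*z + γ7*y*z^2 ∈ K[x,y,z] with γ6 ≠ 0 and β = γ6·a3/a11. Regard F(x,y) = f(x,y,1) and C(x,y) = c(x,y,1) as polynomials in y with coefficients in K[x], so F has degree 3 in y with leading coefficient a11 and C has degree 2 in y with leading coefficient γ6. Then the resultant of F and C with respect to y is a polynomial in K[x] of degree at most 9. -/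

import Mathlib

/-- The Sylvester matrix of `p` and `q`, regarded as polynomials of degree `m`
and `n` respectively: the first `n` rows contain the shifted coefficient vectors
of `p`, the last `m` rows those of `q`. -/
noncomputable def sylvesterMatrix {R : Type*} [CommRing R] (m n : ℕ) (p q : Polynomial R) :
    Matrix (Fin (n + m)) (Fin (n + m)) R :=
  Matrix.of fun i j =>
    if (i : ℕ) < n then
      (if (i : ℕ) ≤ (j : ℕ) ∧ (j : ℕ) ≤ (i : ℕ) + m then p.coeff (m + i - j) else 0)
    else
      (if (i : ℕ) - n ≤ (j : ℕ) ∧ (j : ℕ) ≤ (i : ℕ) then q.coeff ((i : ℕ) - j) else 0)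

/-- The resultant of `p` and `q`, regarded as polynomials of degree `m` and `n`:
the determinant of their Sylvester matrix. -/
noncomputable def resultant {R : Type*} [CommRing R] (m n : ℕ) (p q : Polynomial R) : R :=
  (sylvesterMatrix m n p q).det

open Polynomial in
/-- The Sylvester determinant of a cubic and a quadratic, after subtracting from the cubic the
multiple `k * y` of the quadratic that kills its leading term. -/
theorem resultant_three_two_of_coeff {R : Type*} [CommRing R] (p q : R[X])
    (k b q1 q0 r2 r1 r0 : R)
    (hp3 : p.coeff 3 = k * b) (hp2 : p.coeff 2 = k * q1 + r2)
    (hp1 : p.coeff 1 = k * q0 + r1) (hp0 : p.coeff 0 = r0)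
    (hq2 : q.coeff 2 = b) (hq1 : q.coeff 1 = q1) (hq0 : q.coeff 0 = q0) :
    _root_.resultant 3 2 p q =
      b * ((r2 * q0 - r0 * b) ^ 2 - (r2 * q1 - r1 * b) * (r1 * q0 - r0 * q1)) := by
  simp [_root_.resultant, sylvesterMatrix, Matrix.det_succ_row_zero, Fin.sum_univ_succ,
    Fin.succAbove, hp3, hp2, hp1, hp0, hq2, hq1, hq0]
  ring

open Polynomial in
theorem natDegree_reduced_resultant_le {R : Type*} [CommRing R] (b : R) (q1 q0 r2 r1 r0 : R[X])
    (hq1 : q1.natDegree ≤ 2) (hq0 : q0.natDegree ≤ 3) (hr2 : r2.natDegree ≤ 1)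
    (hr1 : r1.natDegree ≤ 3) (hr0 : r0.natDegree ≤ 4) :
    (C b * ((r2 * q0 - r0 * C b) ^ 2 -
      (r2 * q1 - r1 * C b) * (r1 * q0 - r0 * q1))).natDegree ≤ 9 := by
  have hb : (C b : R[X]).natDegree ≤ 0 := (natDegree_C b).le
  have h1 : (r2 * q0 - r0 * C b).natDegree ≤ 4 :=
    natDegree_sub_le_of_le (natDegree_mul_le_of_le hr2 hq0) (natDegree_mul_le_of_le hr0 hb)
  have h2 : (r2 * q1 - r1 * C b).natDegree ≤ 3 :=
    natDegree_sub_le_of_le (natDegree_mul_le_of_le hr2 hq1) (natDegree_mul_le_of_le hr1 hb)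
  have h3 : (r1 * q0 - r0 * q1).natDegree ≤ 6 :=
    natDegree_sub_le_of_le (natDegree_mul_le_of_le hr1 hq0) (natDegree_mul_le_of_le hr0 hq1)
  exact (natDegree_C_mul_le _ _).trans <| (natDegree_sub_le_of_le
    (natDegree_pow_le_of_le 2 h1) (natDegree_mul_le_of_le h2 h3)).trans (by norm_num)

/-- Let `f` be the general homogeneous quartic over a field `K` with
`a10 = 0`, `a6 = 0`, `a11 ≠ 0`, and let
`c = γ1*x^3 + γ2*z^3 + β*x^2*y + γ3*x^2*z + γ4*x*z^2 + γ5*x*y*z + γ6*y^2*z + γ7*y*z^2`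
with `γ6 ≠ 0` and `β = γ6·a3/a11`. Regard `F(x,y) = f(x,y,1)` and
`Cc(x,y) = c(x,y,1)` as polynomials in `y` with coefficients in `K[x]`. Then `F`
has degree `3` in `y` with leading coefficient `a11`, `Cc` has degree `2` in `y`
with leading coefficient `γ6`, and the resultant of `F` and `Cc` with respect to
`y` is a polynomial in `K[x]` of degree at most `9`. -/
theorem statement8 (K : Type*) [Field K]
    (a0 a1 a2 a3 a4 a5 a6 a7 a8 a9 a10 a11 a12 a13 a14 : K)
    (f : MvPolynomial (Fin 3) K)
    (hf : f = MvPolynomial.C a0 * MvPolynomial.X 0 ^ 4 +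
      MvPolynomial.C a1 * MvPolynomial.X 0 ^ 3 * MvPolynomial.X 1 +
      MvPolynomial.C a2 * MvPolynomial.X 0 ^ 3 * MvPolynomial.X 2 +
      MvPolynomial.C a3 * MvPolynomial.X 0 ^ 2 * MvPolynomial.X 1 ^ 2 +
      MvPolynomial.C a4 * MvPolynomial.X 0 ^ 2 * MvPolynomial.X 1 * MvPolynomial.X 2 +
      MvPolynomial.C a5 * MvPolynomial.X 0 ^ 2 * MvPolynomial.X 2 ^ 2 +
      MvPolynomial.C a6 * MvPolynomial.X 0 * MvPolynomial.X 1 ^ 3 +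
      MvPolynomial.C a7 * MvPolynomial.X 0 * MvPolynomial.X 1 ^ 2 * MvPolynomial.X 2 +
      MvPolynomial.C a8 * MvPolynomial.X 0 * MvPolynomial.X 1 * MvPolynomial.X 2 ^ 2 +
      MvPolynomial.C a9 * MvPolynomial.X 0 * MvPolynomial.X 2 ^ 3 +
      MvPolynomial.C a10 * MvPolynomial.X 1 ^ 4 +
      MvPolynomial.C a11 * MvPolynomial.X 1 ^ 3 * MvPolynomial.X 2 +
      MvPolynomial.C a12 * MvPolynomial.X 1 ^ 2 * MvPolynomial.X 2 ^ 2 +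
      MvPolynomial.C a13 * MvPolynomial.X 1 * MvPolynomial.X 2 ^ 3 +
      MvPolynomial.C a14 * MvPolynomial.X 2 ^ 4)
    (h10 : a10 = 0) (h6 : a6 = 0) (h11 : a11 ≠ 0)
    (β γ1 γ2 γ3 γ4 γ5 γ6 γ7 : K) (hγ6 : γ6 ≠ 0) (hβ : β = γ6 * a3 / a11)
    (c : MvPolynomial (Fin 3) K)
    (hc : c = MvPolynomial.C γ1 * MvPolynomial.X 0 ^ 3 +
      MvPolynomial.C γ2 * MvPolynomial.X 2 ^ 3 +
      MvPolynomial.C β * MvPolynomial.X 0 ^ 2 * MvPolynomial.X 1 +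
      MvPolynomial.C γ3 * MvPolynomial.X 0 ^ 2 * MvPolynomial.X 2 +
      MvPolynomial.C γ4 * MvPolynomial.X 0 * MvPolynomial.X 2 ^ 2 +
      MvPolynomial.C γ5 * MvPolynomial.X 0 * MvPolynomial.X 1 * MvPolynomial.X 2 +
      MvPolynomial.C γ6 * MvPolynomial.X 1 ^ 2 * MvPolynomial.X 2 +
      MvPolynomial.C γ7 * MvPolynomial.X 1 * MvPolynomial.X 2 ^ 2)
    (F Cc : Polynomial (Polynomial K))
    (hF : F = MvPolynomial.aeval
      (![Polynomial.C Polynomial.X, Polynomial.X, 1] : Fin 3 → Polynomial (Polynomial K)) f)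
    (hCc : Cc = MvPolynomial.aeval
      (![Polynomial.C Polynomial.X, Polynomial.X, 1] : Fin 3 → Polynomial (Polynomial K)) c) :
    F.degree = 3 ∧ F.leadingCoeff = Polynomial.C a11 ∧
    Cc.degree = 2 ∧ Cc.leadingCoeff = Polynomial.C γ6 ∧
    (resultant 3 2 F Cc).natDegree ≤ 9 := by
  have hFexp : F = Polynomial.C (Polynomial.C a11) * Polynomial.X ^ 3 +
      Polynomial.C (Polynomial.C a3 * Polynomial.X ^ 2 + Polynomial.C a7 * Polynomial.X +
        Polynomial.C a12) * Polynomial.X ^ 2 +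
      Polynomial.C (Polynomial.C a1 * Polynomial.X ^ 3 + Polynomial.C a4 * Polynomial.X ^ 2 +
        Polynomial.C a8 * Polynomial.X + Polynomial.C a13) * Polynomial.X +
      Polynomial.C (Polynomial.C a0 * Polynomial.X ^ 4 + Polynomial.C a2 * Polynomial.X ^ 3 +
        Polynomial.C a5 * Polynomial.X ^ 2 + Polynomial.C a9 * Polynomial.X +
        Polynomial.C a14) := by
    subst hF hf h10 h6
    simp [MvPolynomial.algHom_C, Polynomial.algebraMap_apply]
    ring
  have hCexp : Cc = Polynomial.C (Polynomial.C γ6) * Polynomial.X ^ 2 +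
      Polynomial.C (Polynomial.C β * Polynomial.X ^ 2 + Polynomial.C γ5 * Polynomial.X +
        Polynomial.C γ7) * Polynomial.X +
      Polynomial.C (Polynomial.C γ1 * Polynomial.X ^ 3 + Polynomial.C γ3 * Polynomial.X ^ 2 +
        Polynomial.C γ4 * Polynomial.X + Polynomial.C γ2) := by
    subst hCc hc
    simp [MvPolynomial.algHom_C, Polynomial.algebraMap_apply]
    ring
  have ha : Polynomial.C a11 ≠ 0 := Polynomial.C_ne_zero.mpr h11
  have hγ : Polynomial.C γ6 ≠ 0 := Polynomial.C_ne_zero.mpr hγ6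
  refine ⟨hFexp ▸ Polynomial.degree_cubic ha, hFexp ▸ Polynomial.leadingCoeff_cubic ha,
    hCexp ▸ Polynomial.degree_quadratic hγ, hCexp ▸ Polynomial.leadingCoeff_quadratic hγ, ?_⟩
  have hk : a11 / γ6 * γ6 = a11 := div_mul_cancel₀ a11 hγ6
  have hkβ : a11 / γ6 * β = a3 := by rw [hβ]; field_simp
  generalize a11 / γ6 = k at hk hkβ
  subst hk hkβ
  rw [resultant_three_two_of_coeff F Cc (Polynomial.C k) (Polynomial.C γ6)
    (Polynomial.C β * Polynomial.X ^ 2 + Polynomial.C γ5 * Polynomial.X + Polynomial.C γ7)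
    (Polynomial.C γ1 * Polynomial.X ^ 3 + Polynomial.C γ3 * Polynomial.X ^ 2 +
      Polynomial.C γ4 * Polynomial.X + Polynomial.C γ2)
    (Polynomial.C (a7 - k * γ5) * Polynomial.X + Polynomial.C (a12 - k * γ7))
    (Polynomial.C (a1 - k * γ1) * Polynomial.X ^ 3 +
      Polynomial.C (a4 - k * γ3) * Polynomial.X ^ 2 +
      Polynomial.C (a8 - k * γ4) * Polynomial.X + Polynomial.C (a13 - k * γ2))
    (Polynomial.C a0 * Polynomial.X ^ 4 + Polynomial.C a2 * Polynomial.X ^ 3 +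
      Polynomial.C a5 * Polynomial.X ^ 2 + Polynomial.C a9 * Polynomial.X + Polynomial.C a14)]
  · apply natDegree_reduced_resultant_le <;> compute_degree
  all_goals
    simp only [hFexp, hCexp, Polynomial.coeff_add, Polynomial.coeff_C_mul,
      Polynomial.coeff_X_pow, Polynomial.coeff_X, Polynomial.coeff_C]
    simp
  all_goals ring
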